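/- Let V be a finite type, let x : V → V → ℝ be nonnegative arc flows whose support digraph {(i, j) | x i j > 0} contains no directed cycle, and let p : V → ℝ be the divergence of x, i.e., for every node j, (∑_k x j k) − (∑_i x i j) = p j. Then every arc flow is bounded by the total supply: for every pair (a, b), x a b ≤ ∑_j max (p j) 0. -/

import Mathlib

theorem Relation.TransGen.exists_fin_chain {V : Type*} {r : V → V → Prop} {a b : V}
    (h : Relation.TransGen r a b) :
    ∃ k : ℕ, 1 ≤ k ∧ ∃ v : Fin (k + 1) → V, v 0 = a ∧ v (Fin.last k) = b ∧
      ∀ t : Fin k, r (v t.castSucc) (v t.succ) := by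
  induction h using Relation.TransGen.head_induction_on with
  | single h => exact ⟨1, le_rfl, ![_, b], rfl, rfl, by simpa [Fin.forall_fin_one] using h⟩
  | @head c d hcd _ ih =>
    obtain ⟨k, _, v, hv0, hvl, hv⟩ := ih
    refine ⟨k + 1, by omega, Fin.cons c v, by simp, by simpa [← Fin.succ_last] using hvl, ?_⟩
    intro t
    cases t using Fin.cases with
    | zero => simpa [hv0] using hcd
    | succ t => simpa [← Fin.succ_castSucc] using hv t

/-- If no flow enters `S` from outside, any arc leaving `S` carries at most the net supply
of `S`. -/
theorem le_sum_divergence_of_leaving {V : Type*} [Fintype V] {x : V → V → ℝ}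
    (hx : ∀ i j, 0 ≤ x i j) {S : Finset V} (hS : ∀ i ∉ S, ∀ j ∈ S, x i j = 0)
    {a b : V} (ha : a ∈ S) (hb : b ∉ S) :
    x a b ≤ ∑ j ∈ S, ((∑ k, x j k) - ∑ i, x i j) := by
  classical
  have hin : ∑ j ∈ S, ∑ i, x i j = ∑ j ∈ S, ∑ k ∈ S, x j k := by
    rw [Finset.sum_comm (s := S) (t := S)]
    exact Finset.sum_congr rfl fun j hj ↦
      (Finset.sum_subset S.subset_univ fun i _ hi ↦ hS i hi j hj).symm
  have hout : ∑ j ∈ S, ∑ k, x j k = ∑ j ∈ S, ∑ k ∈ S, x j k + ∑ j ∈ S, ∑ k ∈ Sᶜ, x j k := by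
    simp only [← Finset.sum_add_distrib, Finset.sum_add_sum_compl]
  rw [Finset.sum_sub_distrib, hin, hout, add_sub_cancel_left]
  calc x a b ≤ ∑ k ∈ Sᶜ, x a k :=
        Finset.single_le_sum (f := x a) (fun k _ ↦ hx a k) (Finset.mem_compl.2 hb)
    _ ≤ ∑ j ∈ S, ∑ k ∈ Sᶜ, x j k :=
        Finset.single_le_sum (f := fun j ↦ ∑ k ∈ Sᶜ, x j k)
          (fun j _ ↦ Finset.sum_nonneg fun k _ ↦ hx j k) ha

/-- Flow bound by total supply: if nonnegative arc flows have an acyclic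
positive-flow support and divergence `p`, then every arc flow is bounded by
the total positive supply `∑ j, max (p j) 0`. -/
theorem flow_bounded_by_total_supply (V : Type*) [Fintype V]
    (x : V → V → ℝ) (hx : ∀ i j, 0 ≤ x i j)
    (hacyc : ¬ ∃ k : ℕ, 1 ≤ k ∧ ∃ v : Fin (k + 1) → V, v 0 = v (Fin.last k) ∧
        ∀ t : Fin k, 0 < x (v t.castSucc) (v t.succ))
    (p : V → ℝ) (hp : ∀ j, (∑ k, x j k) - (∑ i, x i j) = p j) :
    ∀ a b, x a b ≤ ∑ j, max (p j) 0 := by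
  intro a b
  classical
  rcases (hx a b).eq_or_lt with h0 | hab
  · rw [← h0]
    exact Finset.sum_nonneg fun j _ ↦ le_max_right _ _
  let r : V → V → Prop := fun i j ↦ 0 < x i j
  let S : Finset V := Finset.univ.filter fun v ↦ Relation.ReflTransGen r v a
  have mem_S (v : V) : v ∈ S ↔ Relation.ReflTransGen r v a := by simp [S]
  have hS : ∀ i ∉ S, ∀ j ∈ S, x i j = 0 := by
    intro i hi j hj
    by_contra hne
    exact hi ((mem_S i).2 (.head ((hx i j).lt_of_ne' hne) ((mem_S j).1 hj)))
  have hb : b ∉ S := by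
    intro hb
    obtain ⟨k, hk, v, hv0, hvl, hv⟩ :=
      (Relation.TransGen.head' (show r a b from hab) ((mem_S b).1 hb)).exists_fin_chain
    exact hacyc ⟨k, hk, v, hv0.trans hvl.symm, hv⟩
  calc x a b ≤ ∑ j ∈ S, ((∑ k, x j k) - ∑ i, x i j) :=
        le_sum_divergence_of_leaving hx hS ((mem_S a).2 .refl) hb
    _ = ∑ j ∈ S, p j := Finset.sum_congr rfl fun j _ ↦ hp j
    _ ≤ ∑ j ∈ S, max (p j) 0 := Finset.sum_le_sum fun j _ ↦ le_max_left _ _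
    _ ≤ ∑ j, max (p j) 0 :=
        Finset.sum_le_sum_of_subset_of_nonneg S.subset_univ fun j _ _ ↦ le_max_right _ _
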